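/- Let h ∈ 𝒞, φ ∈ C^∞(S^{n-1}), and ε > 0 be such that h + sφ ∈ 𝒞 for every s ∈ (-ε, ε), and set f(s) = F(h + sφ). Then f''(0) = ∫_{S^{n-1}} φ Σ_{i,j=1}^{n-1} c_ij (φ_ij + φ δ_ij) dℋ^{n-1}, where (c_ij) is the cofactor matrix of (h_ij + h δ_ij). -/

import Mathlib

open MeasureTheory Metric
open scoped RealInnerProductSpace ENNReal

noncomputable section

/-- Euclidean `n`-space. -/
abbrev E (n : ℕ) : Type := EuclideanSpace ℝ (Fin n)

/-- Orthogonal projection onto the tangent space `u^⊥` of the sphere at a unit vector `u`. -/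
noncomputable def tproj {n : ℕ} (u : E n) : E n →L[ℝ] E n :=
  ContinuousLinearMap.id ℝ (E n) - (innerSL ℝ u).smulRight u

/-- The second derivative of `h` at `u` as an endomorphism of `ℝⁿ`.  For a function on the
sphere, identified with its `1`-homogeneous extension, its restriction to the tangent space
`u^⊥` is represented in any orthonormal frame by the matrix `(h_ij + h δ_ij)`. -/
noncomputable def sHess {n : ℕ} (h : E n → ℝ) (u : E n) : E n →L[ℝ] E n :=
  fderiv ℝ (gradient h) u

/-- `det(h_ij + h δ_ij)(u)`: the determinant of the restriction of `sHess h u` to the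
tangent space `u^⊥`. -/
noncomputable def sdet {n : ℕ} (h : E n → ℝ) (u : E n) : ℝ :=
  LinearMap.det
    (((tproj u).comp ((sHess h u).comp (tproj u)) + (innerSL ℝ u).smulRight u :
      E n →L[ℝ] E n) : E n →ₗ[ℝ] E n)

/-- Positive `1`-homogeneity; functions on the sphere are identified with their
`1`-homogeneous extensions. -/
def homog1 {n : ℕ} (h : E n → ℝ) : Prop := ∀ t : ℝ, 0 < t → ∀ x : E n, h (t • x) = t * h x

/-- `h ∈ 𝒞`: (the `1`-homogeneous extension of) a function of class `C²` on the sphere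
such that the matrix `(h_ij + h δ_ij)` is positive definite at every point of the sphere. -/
def memC (n : ℕ) (h : E n → ℝ) : Prop :=
  homog1 h ∧ ContDiffOn ℝ 2 h {(0 : E n)}ᶜ ∧
    ∀ u ∈ sphere (0 : E n) 1, ∀ v ∈ (ℝ ∙ u)ᗮ, v ≠ 0 → 0 < ⟪sHess h u v, v⟫

/-- The volume functional `F(h) = (1/n) ∫_{S^{n-1}} h det(h_ij + h δ_ij) dℋ^{n-1}`. -/
noncomputable def volF (n : ℕ) (h : E n → ℝ) : ℝ :=
  (1 / n : ℝ) * ∫ u in sphere (0 : E n) 1, h u * sdet h u ∂μH[(n : ℝ) - 1]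

section

open Filter Topology

/-! ### Hausdorff measure on the sphere -/

theorem hausdorffMeasure_sphere_lt_top {n : ℕ} (hn : 1 ≤ n) :
    μH[(n : ℝ) - 1] (sphere (0 : E n) 1) < ∞ := by
  classical
  let ψ (i : Fin n) (a : ℝ) : ({j : Fin n // j ≠ i} → ℝ) → E n := fun y =>
    WithLp.toLp 2 fun j => if hj : j = i then a else y ⟨j, hj⟩
  let Ψ (i : Fin n) (a : ℝ) : ({j : Fin n // j ≠ i} → ℝ) → E n := fun y => ‖ψ i a y‖⁻¹ • ψ i a y
  have hψ : ∀ i a, ContDiff ℝ 1 (ψ i a) := by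
    intro i a
    rw [contDiff_euclidean]
    intro j
    by_cases hj : j = i
    · simp only [ψ, hj, dite_true]; exact contDiff_const
    · simp only [ψ, hj, dite_false]; fun_prop
  have hne : ∀ i a y, a ≠ 0 → ψ i a y ≠ 0 := by
    intro i a y ha h0
    have : ψ i a y i = 0 := by rw [h0]; rfl
    exact ha (by simpa [ψ] using this)
  have hΨ : ∀ i a, a ≠ 0 → ContDiff ℝ 1 (Ψ i a) := by
    intro i a ha
    have h1 : ContDiff ℝ 1 fun y => ‖ψ i a y‖ := (hψ i a).norm ℝ (fun y => hne i a y ha)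
    exact (h1.inv fun y => norm_ne_zero_iff.2 (hne i a y ha)).smul (hψ i a)
  have hcover : sphere (0 : E n) 1 ⊆ ⋃ i : Fin n, ⋃ a ∈ ({1, -1} : Finset ℝ),
      Ψ i a '' closedBall 0 1 := by
    intro u hu
    have hu1 : ‖u‖ = 1 := by simpa using hu
    have : Nonempty (Fin n) := ⟨⟨0, hn⟩⟩
    obtain ⟨i, hi⟩ := Finite.exists_max fun i => |u i|
    have hui : u i ≠ 0 := by
      intro h0
      have : u = 0 := by
        ext j
        have := hi j
        simp only [h0, abs_zero] at this
        simpa using abs_nonpos_iff.1 this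
      simp [this] at hu1
    have key : ψ i (SignType.sign (u i) : ℝ) (fun j => |u i|⁻¹ * u j) = |u i|⁻¹ • u := by
      ext j
      by_cases hj : j = i
      · subst hj
        simp only [ψ, dite_true, PiLp.smul_apply, smul_eq_mul]
        rw [eq_inv_mul_iff_mul_eq₀ (abs_ne_zero.2 hui), mul_comm, sign_mul_abs]
      · simp [ψ, hj]
    simp only [Set.mem_iUnion]
    refine ⟨i, (SignType.sign (u i) : ℝ), ?_, fun j => |u i|⁻¹ * u j, ?_, ?_⟩
    · rcases lt_or_gt_of_ne hui with h | h
      · simp [sign_neg h]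
      · simp [sign_pos h]
    · rw [mem_closedBall_zero_iff, pi_norm_le_iff_of_nonneg zero_le_one]
      intro j
      rw [norm_mul, norm_inv, Real.norm_eq_abs, Real.norm_eq_abs, abs_abs,
        inv_mul_le_iff₀ (abs_pos.2 hui), mul_one]
      exact hi j
    · simp only [Ψ]
      rw [key, norm_smul, hu1, norm_inv, Real.norm_eq_abs, abs_abs, mul_one, inv_inv, smul_smul,
        mul_inv_cancel₀ (abs_ne_zero.2 hui), one_smul]
  refine (measure_mono hcover).trans_lt ?_
  refine (measure_iUnion_le _).trans_lt ?_
  rw [tsum_fintype]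
  refine ENNReal.sum_lt_top.2 fun i _ => ?_
  refine (measure_biUnion_finset_le _ _).trans_lt (ENNReal.sum_lt_top.2 fun a ha => ?_)
  have ha0 : a ≠ 0 := by
    simp only [Finset.mem_insert, Finset.mem_singleton] at ha
    rcases ha with rfl | rfl <;> norm_num
  obtain ⟨K, hK⟩ := ((hΨ i a ha0).contDiffOn (s := closedBall 0 1)).exists_lipschitzOnWith
    one_ne_zero (convex_closedBall _ _) (isCompact_closedBall _ _)
  have hd : (n : ℝ) - 1 = (Fintype.card {j : Fin n // j ≠ i} : ℝ) := by
    simp [Nat.cast_sub hn]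
  have hd0 : (0 : ℝ) ≤ (n : ℝ) - 1 := by rw [hd]; positivity
  refine (hK.hausdorffMeasure_image_le hd0).trans_lt ?_
  refine ENNReal.mul_lt_top (ENNReal.rpow_lt_top_of_nonneg hd0 ENNReal.coe_ne_top) ?_
  rw [hd, hausdorffMeasure_pi_real]
  exact (isCompact_closedBall _ _).measure_lt_top

/-- The `(n-1)`-dimensional Hausdorff measure on the unit sphere, as a measure on `ℝⁿ`. -/
def sphereMeasure (n : ℕ) : Measure (E n) := μH[(n : ℝ) - 1].restrict (sphere 0 1)

theorem isFiniteMeasure_sphereMeasure {n : ℕ} (hn : 1 ≤ n) : IsFiniteMeasure (sphereMeasure n) :=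
  ⟨by simpa [sphereMeasure] using hausdorffMeasure_sphere_lt_top hn⟩

theorem ae_mem_sphere (n : ℕ) : ∀ᵐ u ∂sphereMeasure n, u ∈ sphere (0 : E n) 1 :=
  ae_restrict_mem isClosed_sphere.measurableSet

theorem map_sphereMeasure {n : ℕ} (R : E n ≃ₗᵢ[ℝ] E n) :
    (sphereMeasure n).map R = sphereMeasure n := by
  have h := R.toIsometryEquiv.map_hausdorffMeasure ((n : ℝ) - 1)
  have h2 := Measure.restrict_map (μ := μH[(n : ℝ) - 1])
    (R.toIsometryEquiv.continuous.measurable)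
    (isClosed_sphere (x := (0 : E n)) (ε := 1)).measurableSet
  rw [h] at h2
  have hp' : R.toIsometryEquiv ⁻¹' sphere (0 : E n) 1 = sphere 0 1 := by
    ext; simp
  rw [hp'] at h2
  exact h2.symm

theorem integral_comp_isometry {n : ℕ} (R : E n ≃ₗᵢ[ℝ] E n) (g : E n → ℝ) :
    ∫ u, g (R u) ∂sphereMeasure n = ∫ u, g u ∂sphereMeasure n := by
  conv_rhs => rw [← map_sphereMeasure R]
  exact (R.toHomeomorph.measurableEmbedding.integral_map g).symm

theorem integrable_sphereMeasure {n : ℕ} (hn : 1 ≤ n) {g : E n → ℝ}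
    (hg : ContinuousOn g (sphere 0 1)) : Integrable g (sphereMeasure n) := by
  have := isFiniteMeasure_sphereMeasure hn
  obtain ⟨C, hC⟩ := (isCompact_sphere (0 : E n) 1).exists_bound_of_continuousOn hg
  refine Integrable.of_bound (hg.aestronglyMeasurable isClosed_sphere.measurableSet) C ?_
  filter_upwards [ae_mem_sphere n] with u hu using hC u hu

theorem hasDerivAt_integral_sphere {n : ℕ} (hn : 1 ≤ n) {G G' : ℝ → E n → ℝ}
    (hG : ∀ t, ContinuousOn (G t) (sphere 0 1))
    (hG' : ContinuousOn (fun p : ℝ × E n => G' p.1 p.2) (Set.univ ×ˢ sphere 0 1))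
    (hd : ∀ t, ∀ u ∈ sphere (0 : E n) 1, HasDerivAt (fun t => G t u) (G' t u) t) (t₀ : ℝ) :
    HasDerivAt (fun t => ∫ u, G t u ∂sphereMeasure n) (∫ u, G' t₀ u ∂sphereMeasure n) t₀ := by
  have := isFiniteMeasure_sphereMeasure hn
  obtain ⟨C, hC⟩ := ((isCompact_closedBall t₀ 1).prod
    (isCompact_sphere (0 : E n) 1)).exists_bound_of_continuousOn
    (hG'.mono (Set.prod_mono (Set.subset_univ _) subset_rfl))
  have hG't : ContinuousOn (G' t₀) (sphere 0 1) :=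
    hG'.comp (f := fun u => (t₀, u)) (by fun_prop) fun u hu => ⟨Set.mem_univ _, hu⟩
  refine (hasDerivAt_integral_of_dominated_loc_of_deriv_le (F' := G') (bound := fun _ => C)
    (closedBall_mem_nhds t₀ one_pos) (.of_forall fun t => ?_) (integrable_sphereMeasure hn (hG t₀))
    ?_ ?_ (integrable_const C) ?_).2
  · exact (hG t).aestronglyMeasurable isClosed_sphere.measurableSet
  · exact hG't.aestronglyMeasurable isClosed_sphere.measurableSet
  · filter_upwards [ae_mem_sphere n] with u hu t ht using hC (t, u) ⟨ht, hu⟩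
  · filter_upwards [ae_mem_sphere n] with u hu t _ using hd t u hu

theorem mem_compl_zero_of_mem_sphere {n : ℕ} {u : E n} (hu : u ∈ sphere (0 : E n) 1) :
    u ∈ ({0}ᶜ : Set (E n)) :=
  ne_zero_of_mem_unit_sphere ⟨u, hu⟩

/-- Derivatives along infinitesimal rotations integrate to zero over the sphere. -/
theorem integral_fderiv_skew_eq_zero {n : ℕ} (hn : 1 ≤ n) {g : E n → ℝ}
    (hg : ContDiffOn ℝ 1 g {0}ᶜ) (Ω : E n →L[ℝ] E n) (hΩ : Ω ∈ skewAdjoint (E n →L[ℝ] E n)) :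
    ∫ u, fderiv ℝ g u (Ω u) ∂sphereMeasure n = 0 := by
  let _ : NormedAlgebra ℚ (E n →L[ℝ] E n) := NormedAlgebra.restrictScalars ℚ ℝ _
  have hmem : ∀ t : ℝ, NormedSpace.exp (t • Ω) ∈ unitary (E n →L[ℝ] E n) := fun t =>
    NormedSpace.exp_mem_unitary_of_mem_skewAdjoint (skewAdjoint.smul_mem t hΩ)
  let R : ℝ → E n ≃ₗᵢ[ℝ] E n := fun t => Unitary.linearIsometryEquiv ⟨_, hmem t⟩
  have hR : ∀ t u, R t u = NormedSpace.exp (t • Ω) u := fun t u => rfl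
  have hRS : ∀ t, ∀ u ∈ sphere (0 : E n) 1, R t u ∈ sphere (0 : E n) 1 := by
    intro t u hu; simpa using hu
  have hRd : ∀ t u, HasDerivAt (fun t => R t u) (R t (Ω u)) t := by
    intro t u
    simp only [hR]
    simpa using (hasDerivAt_exp_smul_const Ω t).clm_apply (hasDerivAt_const t u)
  have hRc : Continuous fun p : ℝ × E n => R p.1 p.2 := by
    simp only [hR]
    have : Continuous fun t : ℝ => NormedSpace.exp (t • Ω) :=
      continuous_iff_continuousAt.2 fun t => (hasDerivAt_exp_smul_const Ω t).continuousAt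
    exact (this.comp continuous_fst).clm_apply continuous_snd
  have hfc : ContinuousOn (fderiv ℝ g) {0}ᶜ :=
    hg.continuousOn_fderiv_of_isOpen isOpen_compl_singleton le_rfl
  have key := hasDerivAt_integral_sphere hn (G := fun t u => g (R t u))
    (G' := fun t u => fderiv ℝ g (R t u) (R t (Ω u))) ?_ ?_ ?_ 0
  · have h0 : ∀ u, R 0 u = u := fun u => by rw [hR, zero_smul ℝ Ω, NormedSpace.exp_zero]; rfl
    simp only [integral_comp_isometry, h0] at key
    exact key.unique (hasDerivAt_const _ _)
  · intro t
    exact hg.continuousOn.comp (R t).continuous.continuousOn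
      fun u hu => mem_compl_zero_of_mem_sphere (hRS t u hu)
  · refine ContinuousOn.clm_apply (hfc.comp hRc.continuousOn ?_) ?_
    · rintro ⟨t, u⟩ ⟨-, hu⟩
      exact mem_compl_zero_of_mem_sphere (hRS t u hu)
    · exact (hRc.comp (continuous_fst.prodMk (Ω.continuous.comp continuous_snd))).continuousOn
  · intro t u hu
    have hd : DifferentiableAt ℝ g (R t u) := (hg.differentiableOn one_ne_zero).differentiableAt
      (isOpen_compl_singleton.mem_nhds (mem_compl_zero_of_mem_sphere (hRS t u hu)))
    exact hd.hasFDerivAt.comp_hasDerivAt t (hRd t u)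

/-! ### Determinants as functions of their rows -/

/-- The determinant as a continuous multilinear function of the rows. -/
def detRows (n : ℕ) : ContinuousMultilinearMap ℝ (fun _ : Fin n => Fin n → ℝ) ℝ where
  toMultilinearMap := Matrix.detRowAlternating.toMultilinearMap
  cont := Continuous.matrix_det (A := fun M : Matrix (Fin n) (Fin n) ℝ => M) continuous_id

theorem hasFDerivAt_det {n : ℕ} {G : Type*} [NormedAddCommGroup G] [NormedSpace ℝ G]
    {r : G → Matrix (Fin n) (Fin n) ℝ} {r' : Fin n → G →L[ℝ] Fin n → ℝ} {x : G}
    (h : ∀ i, HasFDerivAt (fun y => r y i) (r' i) x) :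
    HasFDerivAt (fun y => (r y).det)
      (∑ i, (detRows n).toContinuousLinearMap (r x) i ∘SL r' i) x :=
  HasFDerivAt.multilinear_comp (detRows n) h

theorem sum_toContinuousLinearMap_apply {n : ℕ} {G : Type*} [NormedAddCommGroup G]
    [NormedSpace ℝ G] (M : Matrix (Fin n) (Fin n) ℝ) (r' : Fin n → G →L[ℝ] Fin n → ℝ) (v : G) :
    (∑ i, (detRows n).toContinuousLinearMap M i ∘SL r' i) v =
      ∑ i, (M.updateRow i (r' i v)).det := by
  simp only [sum_apply]
  rfl

theorem hasDerivAt_det {n : ℕ} {r : ℝ → Matrix (Fin n) (Fin n) ℝ}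
    {r' : Matrix (Fin n) (Fin n) ℝ} {t : ℝ} (h : ∀ i, HasDerivAt (fun y => r y i) (r' i) t) :
    HasDerivAt (fun y => (r y).det) (∑ i, ((r t).updateRow i (r' i)).det) t := by
  have := (hasFDerivAt_det fun i => (h i).hasFDerivAt).hasDerivAt
  rw [sum_toContinuousLinearMap_apply] at this
  simpa using this

theorem contDiff_det_rows {n : ℕ} {m : WithTop ℕ∞} {G : Type*} [NormedAddCommGroup G]
    [NormedSpace ℝ G] {r : G → Matrix (Fin n) (Fin n) ℝ} (h : ∀ i, ContDiff ℝ m fun y => r y i) :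
    ContDiff ℝ m fun y => (r y).det :=
  (detRows n).contDiff.comp (contDiff_pi.2 h)

theorem det_updateRow_eq_sum {n : ℕ} (M : Matrix (Fin n) (Fin n) ℝ) (l : Fin n) (w : Fin n → ℝ) :
    (M.updateRow l w).det = ∑ b, w b * (M.updateRow l (Pi.single b 1)).det := by
  rw [← Matrix.cramer_transpose_apply, Matrix.cramer_eq_adjugate_mulVec,
    ← Matrix.adjugate_transpose,
    Matrix.mulVec, dotProduct]
  simp only [Matrix.transpose_apply, Matrix.adjugate_apply, mul_comm]

theorem det_updateRow_swap {n : ℕ} (M : Matrix (Fin n) (Fin n) ℝ) {k l : Fin n} (hkl : k ≠ l)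
    (v w : Fin n → ℝ) :
    ((M.updateRow k v).updateRow l w).det = -((M.updateRow k w).updateRow l v).det := by
  have h := (Matrix.detRowAlternating (n := Fin n) (R := ℝ)).map_swap
    ((M.updateRow k w).updateRow l v) hkl
  refine Eq.trans ?_ h
  change Matrix.det _ = Matrix.det _
  congr 1
  ext i j
  change _ = ((M.updateRow k w).updateRow l v) (Equiv.swap k l i) j
  by_cases hk : i = k
  · subst hk; simp [hkl]
  by_cases hl : i = l
  · subst hl; simp [hkl]
  · rw [Equiv.swap_apply_of_ne_of_ne hk hl]
    simp [Matrix.updateRow_ne, hk, hl]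

/-- Contracting two rows of a determinant with a symmetric array gives zero. -/
theorem sum_det_updateRow_symm {n : ℕ} (M : Matrix (Fin n) (Fin n) ℝ) {l m : Fin n} (hlm : l ≠ m)
    {H : Fin n → Fin n → ℝ} (hH : ∀ b c, H b c = H c b) :
    ∑ b, ((M.updateRow l (Pi.single b 1)).updateRow m (H b)).det = 0 := by
  have h1 : ∑ b, ((M.updateRow l (Pi.single b 1)).updateRow m (H b)).det =
      ∑ b, ∑ c, H b c *
        ((M.updateRow l (Pi.single b 1)).updateRow m (Pi.single c 1)).det :=
    Finset.sum_congr rfl fun b _ => det_updateRow_eq_sum _ _ _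
  have h2 : ∑ b, ∑ c, H b c *
        ((M.updateRow l (Pi.single b 1)).updateRow m (Pi.single c 1)).det =
      -∑ b, ∑ c, H b c *
        ((M.updateRow l (Pi.single b 1)).updateRow m (Pi.single c 1)).det := by
    conv_lhs => rw [Finset.sum_comm]
    simp only [← Finset.sum_neg_distrib]
    refine Finset.sum_congr rfl fun b _ => Finset.sum_congr rfl fun c _ => ?_
    rw [det_updateRow_swap _ hlm, hH, mul_neg]
  rw [h1]
  linarith

/-! ### Coordinate gradients -/

/-- The vector of partial derivatives of `g` at `u`. -/
def pd {n : ℕ} (g : E n → ℝ) (u : E n) : Fin n → ℝ :=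
  fun b => fderiv ℝ g u (EuclideanSpace.single b 1)

theorem contDiff_pd {n : ℕ} {g : E n → ℝ} (hg : ContDiff ℝ (⊤ : ℕ∞) g) :
    ContDiff ℝ (⊤ : ℕ∞) (pd g) :=
  contDiff_pi.2 fun _ => (hg.fderiv_right (m := (⊤ : ℕ∞)) le_rfl).clm_apply contDiff_const

theorem fderiv_pd_apply {n : ℕ} {g : E n → ℝ} {u : E n} (hg : ContDiffAt ℝ 2 g u) (v : E n)
    (b : Fin n) :
    fderiv ℝ (pd g) u v b = fderiv ℝ (fderiv ℝ g) u v (EuclideanSpace.single b 1) := by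
  have hd : DifferentiableAt ℝ (fderiv ℝ g) u :=
    (hg.fderiv_right (m := 1) (by norm_num)).differentiableAt one_ne_zero
  have h : HasFDerivAt (pd g) (ContinuousLinearMap.pi fun b =>
      (fderiv ℝ (fderiv ℝ g) u).flip (EuclideanSpace.single b 1)) u := by
    rw [hasFDerivAt_pi]
    intro b
    exact (hd.hasFDerivAt.clm_apply (hasFDerivAt_const _ _)).congr_fderiv (by ext; simp)
  rw [h.fderiv]
  rfl

theorem fderiv_pd_symm {n : ℕ} {g : E n → ℝ} {u : E n} (hg : ContDiffAt ℝ 2 g u) (b c : Fin n) :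
    fderiv ℝ (pd g) u (EuclideanSpace.single b 1) c =
      fderiv ℝ (pd g) u (EuclideanSpace.single c 1) b := by
  rw [fderiv_pd_apply hg, fderiv_pd_apply hg]
  exact hg.isSymmSndFDerivAt (by simp) _ _

/-! ### Vanishing of the integral of an exact top-degree form on the sphere -/

/-- The infinitesimal rotation `u ↦ uₐ e_b - u_b eₐ`. -/
def infRot {n : ℕ} (a b : Fin n) : E n →L[ℝ] E n :=
  (EuclideanSpace.proj a).smulRight (EuclideanSpace.single b 1) -
    (EuclideanSpace.proj b).smulRight (EuclideanSpace.single a 1)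

theorem infRot_apply {n : ℕ} (a b : Fin n) (u : E n) :
    infRot a b u = u a • EuclideanSpace.single b 1 - u b • EuclideanSpace.single a 1 := rfl

theorem infRot_mem_skewAdjoint {n : ℕ} (a b : Fin n) :
    infRot a b ∈ skewAdjoint (E n →L[ℝ] E n) := by
  rw [skewAdjoint.mem_iff, ContinuousLinearMap.star_eq_adjoint]
  symm
  rw [ContinuousLinearMap.eq_adjoint_iff]
  intro x y
  simp [infRot_apply, inner_sub_left, inner_sub_right, inner_smul_left, inner_smul_right,
    EuclideanSpace.inner_single_left, EuclideanSpace.inner_single_right]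
  ring

theorem integral_det_pd_eq_zero_of_smooth {n : ℕ} (hn : 1 ≤ n) {g : Fin n → E n → ℝ}
    (hg : ∀ i, ContDiff ℝ (⊤ : ℕ∞) (g i)) {k l : Fin n} (hkl : k ≠ l) :
    ∫ u : E n, ((Matrix.of fun i => pd (g i) u).updateRow k u).det ∂sphereMeasure n = 0 := by
  let N : E n → Matrix (Fin n) (Fin n) ℝ := fun u => Matrix.of fun i => pd (g i) u
  let r : Fin n → Fin n → E n → Matrix (Fin n) (Fin n) ℝ := fun a b u =>
    ((N u).updateRow k (Pi.single a 1)).updateRow l (Pi.single b 1)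
  let D : Fin n → Fin n → E n → ℝ := fun a b u => (r a b u).det
  have hr : ∀ a b i, ContDiff ℝ (⊤ : ℕ∞) fun u => r a b u i := by
    intro a b i
    by_cases hl : i = l
    · subst hl; simpa [r] using contDiff_const
    by_cases hk : i = k
    · subst hk; simpa [r, hl, Matrix.updateRow_ne] using contDiff_const
    · have : (fun u => r a b u i) = pd (g i) := by
        funext u; simp only [r, Matrix.updateRow_ne hl, Matrix.updateRow_ne hk]; rfl
      rw [this]; exact contDiff_pd (hg i)
  have hD : ∀ a b, ContDiff ℝ (⊤ : ℕ∞) (D a b) := fun a b => contDiff_det_rows (hr a b)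
  have hDswap : ∀ a b u, D a b u = -D b a u := fun a b u => det_updateRow_swap _ hkl _ _
  have hdiv : ∀ a u, ∑ b, fderiv ℝ (D a b) u (EuclideanSpace.single b 1) = 0 := by
    intro a u
    have h1 : ∀ b, fderiv ℝ (D a b) u (EuclideanSpace.single b 1) = ∑ m,
        if m = k ∨ m = l then 0 else ((r a b u).updateRow m
          (fderiv ℝ (pd (g m)) u (EuclideanSpace.single b 1))).det := by
      intro b
      rw [(hasFDerivAt_det fun i => ((hr a b i).differentiable (by simp) u).hasFDerivAt).fderiv,
        sum_toContinuousLinearMap_apply]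
      refine Finset.sum_congr rfl fun m _ => ?_
      split_ifs with hm
      · have : (fun u => r a b u m) = fun _ => r a b u m := by
          funext v
          by_cases hl : m = l
          · subst hl; simp [r]
          · have hk := hm.resolve_right hl
            subst hk; simp [r, Matrix.updateRow_ne hl]
        rw [this, fderiv_fun_const]
        exact Matrix.det_eq_zero_of_row_eq_zero m fun j => by simp
      · push Not at hm
        have : (fun u => r a b u m) = pd (g m) := by
          funext u; simp only [r, Matrix.updateRow_ne hm.1, Matrix.updateRow_ne hm.2]; rfl
        rw [this]
    simp only [h1]
    rw [Finset.sum_comm]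
    refine Finset.sum_eq_zero fun m _ => ?_
    split_ifs with hm
    · simp
    · push Not at hm
      exact sum_det_updateRow_symm _ hm.2.symm fun b c =>
        fderiv_pd_symm (contDiff_infty.1 (hg m) 2).contDiffAt b c
  have hpt : ∀ u : E n, ((N u).updateRow k u).det = 1 / 2 * ∑ a, ∑ b,
      fderiv ℝ (fun v => g l v * D a b v) u (infRot a b u) := by
    intro u
    have hgD : ∀ a b v, fderiv ℝ (fun v => g l v * D a b v) u v =
        fderiv ℝ (g l) u v * D a b u + g l u * fderiv ℝ (D a b) u v := by
      intro a b v
      have h1 := ((hg l).differentiable (by simp) u)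
      have h2 := ((hD a b).differentiable (by simp) u)
      rw [fderiv_fun_mul h1 h2]
      simp; ring
    have hDfs : ∀ a b, fderiv ℝ (D a b) u = -fderiv ℝ (D b a) u := by
      intro a b
      rw [← fderiv_neg]
      congr 1
      funext v
      exact hDswap a b v
    have h2 : ∑ a, ∑ b, fderiv ℝ (fun v => g l v * D a b v) u (infRot a b u) =
        2 * ∑ a, ∑ b, u a * fderiv ℝ (fun v => g l v * D a b v) u (EuclideanSpace.single b 1) := by
      simp only [infRot_apply, map_sub, map_smul, smul_eq_mul, Finset.sum_sub_distrib]
      rw [two_mul, sub_eq_add_neg]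
      congr 1
      rw [Finset.sum_comm, ← Finset.sum_neg_distrib]
      refine Finset.sum_congr rfl fun a _ => ?_
      rw [← Finset.sum_neg_distrib]
      refine Finset.sum_congr rfl fun b _ => ?_
      rw [hgD, hgD, hDswap a b, hDfs a b]
      simp; ring
    have h3 : ∑ a, ∑ b, u a * fderiv ℝ (fun v => g l v * D a b v) u (EuclideanSpace.single b 1) =
        ∑ a, u a * ∑ b, pd (g l) u b * D a b u := by
      refine Finset.sum_congr rfl fun a _ => ?_
      rw [← Finset.mul_sum]
      congr 1
      simp only [hgD, Finset.sum_add_distrib, ← Finset.mul_sum, hdiv, mul_zero, add_zero]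
      rfl
    rw [h2, h3, det_updateRow_eq_sum, one_div, inv_mul_cancel_left₀ two_ne_zero]
    refine Finset.sum_congr rfl fun a _ => ?_
    congr 1
    have h4 : (N u).updateRow k (Pi.single a 1) =
        ((N u).updateRow k (Pi.single a 1)).updateRow l (pd (g l) u) := by
      ext i j
      by_cases hl : i = l
      · subst hl; rw [Matrix.updateRow_self, Matrix.updateRow_ne hkl.symm]; rfl
      · rw [Matrix.updateRow_ne hl]
    rw [h4, det_updateRow_eq_sum]
  have hint : ∀ a b, Integrable (fun u => fderiv ℝ (fun v => g l v * D a b v) u (infRot a b u))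
      (sphereMeasure n) := fun a b => integrable_sphereMeasure hn
    ((((hg l).mul (hD a b)).continuous_fderiv (by simp)).clm_apply
      (infRot a b).continuous).continuousOn
  change ∫ u : E n, ((N u).updateRow k u).det ∂sphereMeasure n = 0
  simp only [hpt]
  rw [integral_const_mul,
    integral_finsetSum _ fun a _ => integrable_finsetSum _ fun b _ => hint a b]
  rw [Finset.sum_eq_zero, mul_zero]
  intro a _
  rw [integral_finsetSum _ fun b _ => hint a b]
  exact Finset.sum_eq_zero fun b _ => integral_fderiv_skew_eq_zero hn
    (((hg l).mul (hD a b)).contDiffOn.of_le (by exact_mod_cast le_top)) _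
      (infRot_mem_skewAdjoint a b)

theorem exists_smooth_approx {n : ℕ} {g : E n → ℝ} (hg : ContDiffOn ℝ 1 g {0}ᶜ) :
    ∃ G : ℕ → E n → ℝ, (∀ N, ContDiff ℝ (⊤ : ℕ∞) (G N)) ∧
      (∃ C, ∀ N u b, |pd (G N) u b| ≤ C) ∧
      ∀ u ∈ sphere (0 : E n) 1, Tendsto (fun N => pd (G N) u) atTop (𝓝 (pd g u)) := by
  let A : ContDiffBump (0 : E n) := ⟨2, 3, by norm_num, by norm_num⟩
  let B : ContDiffBump (0 : E n) := ⟨1 / 4, 1 / 2, by norm_num, by norm_num⟩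
  let f : E n → ℝ := fun x => A x * ((1 - B x) * g x)
  have hf : ContDiff ℝ 1 f := by
    rw [contDiff_iff_contDiffAt]
    intro x
    by_cases hx : x = 0
    · subst hx
      have : f =ᶠ[𝓝 0] fun _ => 0 := by
        filter_upwards [closedBall_mem_nhds (0 : E n) (show (0 : ℝ) < 1 / 4 by norm_num)] with x hx
        have : B x = 1 := B.one_of_mem_closedBall hx
        simp [f, this]
      exact contDiffAt_const.congr_of_eventuallyEq this
    · exact A.contDiff.contDiffAt.mul ((contDiffAt_const.sub B.contDiff.contDiffAt).mul
        (hg.contDiffAt (isOpen_compl_singleton.mem_nhds hx)))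
  have hfc : HasCompactSupport f := A.hasCompactSupport.mul_right
  have hfg : ∀ u ∈ sphere (0 : E n) 1, fderiv ℝ f u = fderiv ℝ g u := by
    intro u hu
    have hu1 : ‖u‖ = 1 := by simpa using hu
    refine Filter.EventuallyEq.fderiv_eq ?_
    have h1 : ∀ᶠ x in 𝓝 u, ‖x‖ < 2 := continuous_norm.continuousAt.eventually_lt
      continuousAt_const (by rw [hu1]; norm_num)
    have h2 : ∀ᶠ x in 𝓝 u, 1 / 2 < ‖x‖ := continuousAt_const.eventually_lt
      continuous_norm.continuousAt (by rw [hu1]; norm_num)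
    filter_upwards [h1, h2] with x hx1 hx2
    have hA : A x = 1 := A.one_of_mem_closedBall (by simpa [A] using hx1.le)
    have hB : B x = 0 := B.zero_of_le_dist (by simpa [B] using hx2.le)
    simp [f, hA, hB]
  let φ : ℕ → ContDiffBump (0 : E n) := fun N =>
    ⟨1 / (N + 1) / 2, 1 / (N + 1), by positivity, half_lt_self (by positivity)⟩
  have hφ : Tendsto (fun N => (φ N).rOut) atTop (𝓝 0) := tendsto_one_div_add_atTop_nhds_zero_nat
  let G : ℕ → E n → ℝ := fun N =>
    convolution ((φ N).normed volume) f (ContinuousLinearMap.lsmul ℝ ℝ) volume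
  have hG : ∀ N u, fderiv ℝ (G N) u = convolution ((φ N).normed volume) (fderiv ℝ f)
      (ContinuousLinearMap.lsmul ℝ ℝ) volume u := by
    intro N u
    rw [(hfc.hasFDerivAt_convolution_right (ContinuousLinearMap.lsmul ℝ ℝ)
      ((φ N).continuous_normed.locallyIntegrable) hf u).fderiv]
    rfl
  have hf' : Continuous (fderiv ℝ f) := hf.continuous_fderiv one_ne_zero
  obtain ⟨C, hC⟩ := hf'.bounded_above_of_compact_support (hfc.fderiv (𝕜 := ℝ))
  refine ⟨G, fun N => ?_, ⟨C + (C + C), fun N u b => ?_⟩, fun u hu => ?_⟩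
  · exact (φ N).hasCompactSupport_normed.contDiff_convolution_left _ (φ N).contDiff_normed
      hf.continuous.locallyIntegrable
  · have h1 : dist (fderiv ℝ (G N) u) (fderiv ℝ f u) ≤ C + C := by
      rw [hG]
      exact (φ N).dist_normed_convolution_le hf'.aestronglyMeasurable fun x _ =>
        (dist_le_norm_add_norm _ _).trans (add_le_add (hC x) (hC u))
    have h2 : ‖fderiv ℝ (G N) u‖ ≤ C + (C + C) := by
      rw [dist_eq_norm] at h1
      have := norm_add_le (fderiv ℝ f u) (fderiv ℝ (G N) u - fderiv ℝ f u)
      rw [add_sub_cancel] at this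
      linarith [hC u]
    have h3 := (fderiv ℝ (G N) u).le_opNorm (EuclideanSpace.single b 1)
    rw [PiLp.norm_single, norm_one, mul_one] at h3
    exact h3.trans h2
  · have h1 : Tendsto (fun N => fderiv ℝ (G N) u) atTop (𝓝 (fderiv ℝ g u)) := by
      simp only [hG, ← hfg u hu]
      exact ContDiffBump.convolution_tendsto_right_of_continuous hφ hf' u
    exact tendsto_pi_nhds.2 fun b =>
      ((ContinuousLinearMap.apply ℝ ℝ (EuclideanSpace.single b 1)).continuous.tendsto _).comp h1

theorem integral_det_pd_eq_zero {n : ℕ} (hn : 1 ≤ n) {g : Fin n → E n → ℝ}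
    (hg : ∀ i, ContDiffOn ℝ 1 (g i) {0}ᶜ) {k l : Fin n} (hkl : k ≠ l) :
    ∫ u : E n, ((Matrix.of fun i => pd (g i) u).updateRow k u).det ∂sphereMeasure n = 0 := by
  have := isFiniteMeasure_sphereMeasure hn
  choose G hG hGb hGt using fun i => exists_smooth_approx (hg i)
  choose C hC using hGb
  let K := 1 + ∑ i, |C i|
  have hCK : ∀ i, C i ≤ K := fun i => by
    have := Finset.single_le_sum (f := fun i => |C i|) (fun i _ => abs_nonneg _)
      (Finset.mem_univ i)
    have := le_abs_self (C i)
    simp only [K]; linarith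
  have hK1 : 1 ≤ K := le_add_of_nonneg_right (Finset.sum_nonneg fun i _ => abs_nonneg _)
  have hlim : Tendsto (fun N => ∫ u : E n,
      ((Matrix.of fun i => pd (G i N) u).updateRow k u).det ∂sphereMeasure n) atTop
      (𝓝 (∫ u : E n, ((Matrix.of fun i => pd (g i) u).updateRow k u).det ∂sphereMeasure n)) := by
    refine tendsto_integral_of_dominated_convergence
      (fun _ => (Fintype.card (Fin n)).factorial • K ^ Fintype.card (Fin n)) ?_
      (integrable_const _) ?_ ?_
    · intro N
      refine Continuous.aestronglyMeasurable (Continuous.matrix_det ?_)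
      refine Continuous.matrix_updateRow _ ?_ ?_
      · exact continuous_pi fun i => (contDiff_pd (hG i N)).continuous
      · fun_prop
    · intro N
      filter_upwards [ae_mem_sphere n] with u hu
      refine Matrix.det_le (abv := AbsoluteValue.abs) fun i j => ?_
      change |_| ≤ K
      by_cases hi : i = k
      · subst hi
        rw [Matrix.updateRow_self]
        refine (PiLp.norm_apply_le u j).trans ?_
        rwa [mem_sphere_zero_iff_norm.1 hu]
      · rw [Matrix.updateRow_ne hi]
        exact (hC i N u j).trans (hCK i)
    · filter_upwards [ae_mem_sphere n] with u hu
      have hc : Continuous fun M : Matrix (Fin n) (Fin n) ℝ => (M.updateRow k u).det :=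
        Continuous.matrix_det (Continuous.matrix_updateRow _ continuous_id continuous_const)
      refine (hc.tendsto (Matrix.of fun i => pd (g i) u)).comp ?_
      exact tendsto_pi_nhds.2 fun i => hGt i u hu
  simp only [integral_det_pd_eq_zero_of_smooth hn (fun i => hG i _) hkl] at hlim
  exact tendsto_nhds_unique hlim tendsto_const_nhds |>.symm ▸ rfl

/-! ### Homogeneous functions and their Hessian matrices -/

/-- The Hessian matrix of `h` at `u` in the standard coordinates. -/
def hessMat {n : ℕ} (h : E n → ℝ) (u : E n) : Matrix (Fin n) (Fin n) ℝ :=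
  Matrix.of fun i => pd (fun x => pd h x i) u

theorem fderiv_apply_eq_sum {n : ℕ} (p : E n → ℝ) (u v : E n) :
    fderiv ℝ p u v = ∑ j, pd p u j * v j := by
  conv_lhs => rw [← (EuclideanSpace.basisFun (Fin n) ℝ).sum_repr v]
  simp [pd, mul_comm]

theorem pd_add_const_mul {n : ℕ} {f g : E n → ℝ} {u : E n} (hf : DifferentiableAt ℝ f u)
    (hg : DifferentiableAt ℝ g u) (s : ℝ) :
    pd (fun x => f x + s * g x) u = pd f u + s • pd g u := by
  funext b
  simp only [pd]
  rw [fderiv_fun_add hf (hg.const_mul s), fderiv_const_mul hg]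
  rfl

theorem pd_mul {n : ℕ} {f g : E n → ℝ} {u : E n} (hf : DifferentiableAt ℝ f u)
    (hg : DifferentiableAt ℝ g u) :
    pd (fun x => f x * g x) u = f u • pd g u + g u • pd f u := by
  funext b
  simp only [pd]
  rw [fderiv_fun_mul hf hg]
  rfl

theorem differentiableAt_of_contDiffOn_compl {n : ℕ} {f : E n → ℝ} (hf : ContDiffOn ℝ 1 f {0}ᶜ)
    {u : E n} (hu : u ∈ ({0}ᶜ : Set (E n))) : DifferentiableAt ℝ f u :=
  (hf.contDiffAt (isOpen_compl_singleton.mem_nhds hu)).differentiableAt one_ne_zero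

theorem contDiffOn_pd {n : ℕ} {h : E n → ℝ} (hh : ContDiffOn ℝ 2 h {0}ᶜ) (i : Fin n) :
    ContDiffOn ℝ 1 (fun x => pd h x i) {0}ᶜ :=
  (hh.fderiv_of_isOpen (m := 1) isOpen_compl_singleton (by norm_num)).clm_apply contDiffOn_const

theorem continuousOn_pd {n : ℕ} {f : E n → ℝ} (hf : ContDiffOn ℝ 1 f {0}ᶜ) :
    ContinuousOn (pd f) {0}ᶜ :=
  continuousOn_pi.2 fun _ =>
    (hf.continuousOn_fderiv_of_isOpen isOpen_compl_singleton le_rfl).clm_apply continuousOn_const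

theorem continuousOn_hessMat {n : ℕ} {h : E n → ℝ} (hh : ContDiffOn ℝ 2 h {0}ᶜ) :
    ContinuousOn (hessMat h) {0}ᶜ :=
  continuousOn_pi.2 fun i => continuousOn_pd (contDiffOn_pd hh i)

theorem gradient_eq_toLp_pd {n : ℕ} (h : E n → ℝ) :
    gradient h = fun x => WithLp.toLp 2 (pd h x) := by
  funext x
  ext i
  have := InnerProductSpace.toDual_symm_apply (𝕜 := ℝ) (x := EuclideanSpace.single i (1 : ℝ))
    (y := fderiv ℝ h x)
  rw [EuclideanSpace.inner_single_right] at this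
  simpa [gradient, pd] using this

theorem sHess_apply {n : ℕ} {h : E n → ℝ} (hh : ContDiffOn ℝ 2 h {0}ᶜ) {u : E n}
    (hu : u ∈ ({0}ᶜ : Set (E n))) (v : E n) (i : Fin n) :
    sHess h u v i = ∑ j, hessMat h u i j * v j := by
  have hd : DifferentiableAt ℝ (gradient h) u := by
    rw [gradient_eq_toLp_pd, differentiableAt_euclidean]
    exact fun i => differentiableAt_of_contDiffOn_compl (contDiffOn_pd hh i) hu
  have h1 : HasFDerivAt (fun x => pd h x i) ((EuclideanSpace.proj i).comp (sHess h u)) u := by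
    have hfun : (fun x => pd h x i) = EuclideanSpace.proj (𝕜 := ℝ) i ∘ gradient h := by
      rw [gradient_eq_toLp_pd]
      rfl
    rw [hfun]
    exact (EuclideanSpace.proj (𝕜 := ℝ) i).hasFDerivAt.comp u hd.hasFDerivAt
  change _ = ∑ j, pd (fun x => pd h x i) u j * v j
  rw [← fderiv_apply_eq_sum, h1.fderiv]
  rfl

theorem hessMat_symm {n : ℕ} {h : E n → ℝ} (hh : ContDiffOn ℝ 2 h {0}ᶜ) {u : E n}
    (hu : u ∈ ({0}ᶜ : Set (E n))) (i j : Fin n) : hessMat h u i j = hessMat h u j i := by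
  have hc : ContDiffAt ℝ 2 h u := hh.contDiffAt (isOpen_compl_singleton.mem_nhds hu)
  have hd : ∀ i, DifferentiableAt ℝ (fun x => pd h x i) u := fun i =>
    differentiableAt_of_contDiffOn_compl (contDiffOn_pd hh i) hu
  have key : ∀ i j, hessMat h u i j = fderiv ℝ (pd h) u (EuclideanSpace.single j 1) i := by
    intro i j
    have h1 : fderiv ℝ (pd h) u = ContinuousLinearMap.pi fun i =>
        fderiv ℝ (fun x => pd h x i) u := fderiv_pi (φ := fun i x => pd h x i) hd
    rw [h1]
    rfl
  rw [key, key, fderiv_pd_symm hc]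

theorem pd_smul_of_homog1 {n : ℕ} {h : E n → ℝ} (hom : homog1 h) (hh : ContDiffOn ℝ 2 h {0}ᶜ)
    {u : E n} (hu : u ∈ ({0}ᶜ : Set (E n))) {t : ℝ} (ht : 0 < t) : pd h (t • u) = pd h u := by
  have hd : ∀ x ∈ ({0}ᶜ : Set (E n)), DifferentiableAt ℝ h x := fun x hx =>
    differentiableAt_of_contDiffOn_compl (hh.of_le (by norm_num)) hx
  have htu : t • u ∈ ({0}ᶜ : Set (E n)) := smul_ne_zero ht.ne' hu
  have h1 : HasFDerivAt (fun x => h (t • x)) ((fderiv ℝ h (t • u)).comp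
      (t • ContinuousLinearMap.id ℝ (E n))) u :=
    (hd _ htu).hasFDerivAt.comp u ((hasFDerivAt_id u).const_smul t)
  have h2 : HasFDerivAt (fun x => h (t • x)) (t • fderiv ℝ h u) u := by
    simp only [hom t ht]
    exact (hd u hu).hasFDerivAt.const_mul t
  funext b
  have h3 := congrArg (fun L : E n →L[ℝ] ℝ => L (EuclideanSpace.single b 1)) (h1.unique h2)
  simp only [ContinuousLinearMap.comp_apply, smul_apply, map_smul,
    ContinuousLinearMap.id_apply, smul_eq_mul] at h3
  exact mul_left_cancel₀ ht.ne' h3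

theorem hasDerivAt_smul_one {n : ℕ} {f : E n → ℝ} {u : E n} (hf : DifferentiableAt ℝ f u) :
    HasDerivAt (fun t : ℝ => f (t • u)) (∑ j, pd f u j * u j) 1 := by
  rw [← fderiv_apply_eq_sum]
  have h1 : HasDerivAt (fun t : ℝ => t • u) u 1 := by
    simpa using (hasDerivAt_id (1 : ℝ)).smul_const u
  have h2 : HasFDerivAt f (fderiv ℝ f u) ((1 : ℝ) • u) := by
    rw [one_smul]; exact hf.hasFDerivAt
  exact h2.comp_hasDerivAt 1 h1

/-- Euler's identity for `1`-homogeneous functions. -/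
theorem sum_pd_mul_eq {n : ℕ} {h : E n → ℝ} (hom : homog1 h) (hh : ContDiffOn ℝ 2 h {0}ᶜ)
    {u : E n} (hu : u ∈ ({0}ᶜ : Set (E n))) : ∑ j, pd h u j * u j = h u := by
  refine (hasDerivAt_smul_one (differentiableAt_of_contDiffOn_compl
    (hh.of_le (by norm_num)) hu)).unique ?_
  have h1 : HasDerivAt (fun t : ℝ => t * h u) (h u) 1 := by
    simpa using (hasDerivAt_id (1 : ℝ)).mul_const (h u)
  refine h1.congr_of_eventuallyEq ?_
  filter_upwards [lt_mem_nhds one_pos] with t ht using hom t ht u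

theorem hessMat_mulVec_self {n : ℕ} {h : E n → ℝ} (hom : homog1 h) (hh : ContDiffOn ℝ 2 h {0}ᶜ)
    {u : E n} (hu : u ∈ ({0}ᶜ : Set (E n))) (i : Fin n) : ∑ j, hessMat h u i j * u j = 0 := by
  refine (hasDerivAt_smul_one (differentiableAt_of_contDiffOn_compl (contDiffOn_pd hh i) hu)).unique
    ((hasDerivAt_const 1 (pd h u i)).congr_of_eventuallyEq ?_)
  filter_upwards [lt_mem_nhds one_pos] with t ht
  rw [pd_smul_of_homog1 hom hh hu ht]

theorem contDiffOn_add_const_mul {n : ℕ} {m : WithTop ℕ∞} {h φ : E n → ℝ} {s : Set (E n)}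
    (hh : ContDiffOn ℝ m h s) (hφ : ContDiffOn ℝ m φ s) (t : ℝ) :
    ContDiffOn ℝ m (fun x => h x + t * φ x) s :=
  hh.add (contDiffOn_const.mul hφ)

theorem homog1.add_const_mul {n : ℕ} {h φ : E n → ℝ} (hh : homog1 h) (hφ : homog1 φ) (s : ℝ) :
    homog1 fun x => h x + s * φ x := by
  intro t ht x
  simp only [hh t ht x, hφ t ht x]
  ring

theorem hessMat_add_const_mul {n : ℕ} {h φ : E n → ℝ} (hh : ContDiffOn ℝ 2 h {0}ᶜ)
    (hφ : ContDiffOn ℝ 2 φ {0}ᶜ) {u : E n} (hu : u ∈ ({0}ᶜ : Set (E n))) (s : ℝ) :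
    hessMat (fun x => h x + s * φ x) u = hessMat h u + s • hessMat φ u := by
  ext i j
  have hd : ∀ f : E n → ℝ, ContDiffOn ℝ 2 f {0}ᶜ → ∀ x ∈ ({0}ᶜ : Set (E n)),
      DifferentiableAt ℝ f x := fun f hf x hx =>
    differentiableAt_of_contDiffOn_compl (hf.of_le (by norm_num)) hx
  have h1 : (fun x => pd (fun x => h x + s * φ x) x i) =ᶠ[𝓝 u]
      fun x => pd h x i + s * pd φ x i := by
    filter_upwards [isOpen_compl_singleton.mem_nhds hu] with x hx
    rw [pd_add_const_mul (hd h hh x hx) (hd φ hφ x hx)]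
    rfl
  have h2 := pd_add_const_mul
    (differentiableAt_of_contDiffOn_compl (contDiffOn_pd hh i) hu)
    (differentiableAt_of_contDiffOn_compl (contDiffOn_pd hφ i) hu) s
  have h3 : hessMat (fun x => h x + s * φ x) u i j =
      pd (fun x => pd h x i + s * pd φ x i) u j := by
    simp only [hessMat, Matrix.of_apply, pd]
    exact congrArg (fun L : E n →L[ℝ] ℝ => L (EuclideanSpace.single j 1)) h1.fderiv_eq
  rw [h3, h2]
  rfl

/-! ### The determinant on the tangent space -/

theorem tproj_apply {n : ℕ} (u v : E n) : tproj u v = v - ⟪u, v⟫ • u := rfl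

theorem inner_eq_sum {n : ℕ} (u v : E n) : ⟪u, v⟫ = ∑ i, u i * v i := by
  simp [PiLp.inner_apply, mul_comm]

theorem sum_mul_self_of_mem_sphere {n : ℕ} {u : E n} (hu : u ∈ sphere (0 : E n) 1) :
    ∑ i, u i * u i = 1 := by
  rw [← inner_eq_sum, real_inner_self_eq_norm_sq, mem_sphere_zero_iff_norm.1 hu, one_pow]

theorem sdet_eq_det {n : ℕ} {h : E n → ℝ} (hom : homog1 h) (hh : ContDiffOn ℝ 2 h {0}ᶜ)
    {u : E n} (hu : u ∈ sphere (0 : E n) 1) :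
    sdet h u = (hessMat h u + Matrix.vecMulVec u u).det := by
  have hu0 := mem_compl_zero_of_mem_sphere hu
  rw [sdet, ← LinearMap.det_toMatrix (EuclideanSpace.basisFun (Fin n) ℝ).toBasis]
  congr 1
  ext i j
  have hAu : sHess h u u = 0 := by
    ext i
    rw [sHess_apply hh hu0, hessMat_mulVec_self hom hh hu0]
    rfl
  have huA : ∀ v, ⟪u, sHess h u v⟫ = 0 := by
    intro v
    simp only [inner_eq_sum, sHess_apply hh hu0, Finset.mul_sum]
    rw [Finset.sum_comm]
    refine Finset.sum_eq_zero fun j _ => ?_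
    calc ∑ i, u i * (hessMat h u i j * v j) = (∑ i, hessMat h u j i * u i) * v j := by
          rw [Finset.sum_mul]
          refine Finset.sum_congr rfl fun i _ => ?_
          rw [hessMat_symm hh hu0 i j]; ring
      _ = 0 := by rw [hessMat_mulVec_self hom hh hu0, zero_mul]
  rw [LinearMap.toMatrix_apply]
  simp [tproj_apply, hAu, huA, sHess_apply hh hu0, EuclideanSpace.inner_single_right,
    Matrix.vecMulVec_apply, mul_comm]

theorem det_updateRow_eq_of_mulVec_eq_zero {n : ℕ} {H : Matrix (Fin n) (Fin n) ℝ} {u : Fin n → ℝ}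
    (hsymm : ∀ i j, H i j = H j i) (hHu : ∀ i, ∑ j, H i j * u j = 0)
    (hu : ∑ i, u i * u i = 1) (k : Fin n) :
    (H.updateRow k u).det = (H + Matrix.vecMulVec u u).det * u k := by
  set M := H + Matrix.vecMulVec u u with hM
  have h1 : (H.updateRow k u).det = (M.updateRow k u).det := by
    symm
    refine Matrix.det_eq_of_forall_row_eq_smul_add_const (fun i => if i = k then 0 else u i) k
      (by simp) fun i j => ?_
    by_cases hi : i = k
    · subst hi; simp
    · simp [hi, Matrix.updateRow_ne, hM, Matrix.vecMulVec_apply]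
  have h2 : Matrix.vecMul u M = u := by
    funext j
    have : ∑ i, u i * H i j = 0 := by
      rw [← hHu j]
      exact Finset.sum_congr rfl fun i _ => by rw [hsymm i j, mul_comm]
    simp [Matrix.vecMul, dotProduct, hM, Matrix.vecMulVec_apply, mul_add, Finset.sum_add_distrib,
      this, ← mul_assoc, ← Finset.sum_mul, hu]
  have h3 : Matrix.vecMul u M.adjugate = M.det • u := by
    conv_lhs => rw [← h2]
    rw [Matrix.vecMul_vecMul, Matrix.mul_adjugate, Matrix.vecMul_smul, Matrix.vecMul_one]
  rw [h1, det_updateRow_eq_sum]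
  have h4 := congrFun h3 k
  simpa [Matrix.vecMul, dotProduct, Matrix.adjugate_apply] using h4

theorem det_updateRow_hessMat {n : ℕ} {h : E n → ℝ} (hom : homog1 h) (hh : ContDiffOn ℝ 2 h {0}ᶜ)
    {u : E n} (hu : u ∈ sphere (0 : E n) 1) (k : Fin n) :
    ((hessMat h u).updateRow k u).det = sdet h u * u k := by
  have hu0 := mem_compl_zero_of_mem_sphere hu
  rw [sdet_eq_det hom hh hu, det_updateRow_eq_of_mulVec_eq_zero (hessMat_symm hh hu0)
    (hessMat_mulVec_self hom hh hu0) (sum_mul_self_of_mem_sphere hu)]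

theorem sum_pd_mul_det_updateRow {n : ℕ} {h φ : E n → ℝ} (hom : homog1 h)
    (hh : ContDiffOn ℝ 2 h {0}ᶜ) (hφhom : homog1 φ) (hφ : ContDiffOn ℝ 2 φ {0}ᶜ)
    {u : E n} (hu : u ∈ sphere (0 : E n) 1) :
    ∑ k, pd φ u k * ((hessMat h u).updateRow k u).det = φ u * sdet h u := by
  simp only [det_updateRow_hessMat hom hh hu]
  rw [← sum_pd_mul_eq hφhom hφ (mem_compl_zero_of_mem_sphere hu), Finset.sum_mul]
  exact Finset.sum_congr rfl fun k _ => by ring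

/-! ### Symmetry of the mixed volume functional -/

/-- Integration by parts: a coefficient can be exchanged with the function under a derivative. -/
theorem integral_mul_det_updateRow {n : ℕ} (hn : 1 ≤ n) {g : Fin n → E n → ℝ} {p : E n → ℝ}
    (hg : ∀ i, ContDiffOn ℝ 1 (g i) {0}ᶜ) (hp : ContDiffOn ℝ 1 p {0}ᶜ) {k l : Fin n}
    (hkl : k ≠ l) :
    ∫ u : E n, g k u * (((Matrix.of fun i => pd (g i) u).updateRow k u).updateRow l (pd p u)).det
        ∂sphereMeasure n =
      ∫ u : E n, p u * ((Matrix.of fun i => pd (g i) u).updateRow l u).det ∂sphereMeasure n := by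
  let N : E n → Matrix (Fin n) (Fin n) ℝ := fun u => Matrix.of fun i => pd (g i) u
  have hNc : Continuous fun u : sphere (0 : E n) 1 => N u :=
    continuous_pi fun i => continuousOn_iff_continuous_domRestrict.1
      ((continuousOn_pd (hg i)).mono fun _ => mem_compl_zero_of_mem_sphere)
  have hgc : ∀ f : E n → ℝ, ContDiffOn ℝ 1 f {0}ᶜ → ContinuousOn f (sphere 0 1) := fun f hf =>
    hf.continuousOn.mono fun _ => mem_compl_zero_of_mem_sphere
  have hpc : Continuous fun u : sphere (0 : E n) 1 => pd p u :=
    continuousOn_iff_continuous_domRestrict.1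
      ((continuousOn_pd hp).mono fun _ => mem_compl_zero_of_mem_sphere)
  have huc : Continuous fun u : sphere (0 : E n) 1 => (u : E n).ofLp := by fun_prop
  have hi1 : Integrable (fun u : E n => g k u * (((N u).updateRow k u).updateRow l (pd p u)).det)
      (sphereMeasure n) := integrable_sphereMeasure hn ((hgc _ (hg k)).mul
    (continuousOn_iff_continuous_domRestrict.2
      ((hNc.matrix_updateRow k huc).matrix_updateRow l hpc).matrix_det))
  have hi2 : Integrable (fun u : E n => p u * ((N u).updateRow l u).det) (sphereMeasure n) :=
    integrable_sphereMeasure hn ((hgc _ hp).mul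
      (continuousOn_iff_continuous_domRestrict.2 (hNc.matrix_updateRow l huc).matrix_det))
  rw [← sub_eq_zero, ← integral_sub hi1 hi2]
  have key := integral_det_pd_eq_zero hn (g := Function.update g l fun x => g k x * p x)
    (fun i => by
      by_cases hi : i = l
      · subst hi; simpa using (hg k).mul hp
      · simpa [hi] using hg i) hkl
  rw [← key]
  refine integral_congr_ae ?_
  filter_upwards [ae_mem_sphere n] with u hu
  have hu0 := mem_compl_zero_of_mem_sphere hu
  have h1 : (Matrix.of fun i => pd (Function.update g l (fun x => g k x * p x) i) u).updateRow k u =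
      ((N u).updateRow k u).updateRow l (g k u • pd p u + p u • pd (g k) u) := by
    ext i j
    by_cases hl : i = l
    · subst hl
      rw [Matrix.updateRow_self, Matrix.updateRow_ne hkl.symm, ← pd_mul
        (differentiableAt_of_contDiffOn_compl (hg k) hu0)
        (differentiableAt_of_contDiffOn_compl hp hu0)]
      simp
    · rw [Matrix.updateRow_ne hl]
      by_cases hk : i = k
      · subst hk; simp
      · rw [Matrix.updateRow_ne hk, Matrix.updateRow_ne hk]
        simp [hl, N]
  have h2 : (N u).updateRow k (pd (g k) u) = N u := Matrix.updateRow_eq_self (N u) k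
  rw [h1, Matrix.det_updateRow_add, Matrix.det_updateRow_smul, Matrix.det_updateRow_smul,
    det_updateRow_swap (N u) hkl u.ofLp (pd (g k) u), h2]
  ring

/-- The `k`-th coefficient of the linearised determinant; the `k`-th row stays fixed. -/
def detVariation {n : ℕ} (H K : Matrix (Fin n) (Fin n) ℝ) (u : Fin n → ℝ) (k : Fin n) : ℝ :=
  ∑ l, ((H.updateRow k u).updateRow l (K.updateRow k 0 l)).det

theorem hasDerivAt_det_updateRow {n : ℕ} (H K : Matrix (Fin n) (Fin n) ℝ) (u : Fin n → ℝ)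
    (k : Fin n) (s : ℝ) :
    HasDerivAt (fun s : ℝ => ((H + s • K).updateRow k u).det)
      (detVariation (H + s • K) K u k) s := by
  refine hasDerivAt_det (r' := K.updateRow k 0) fun i => ?_
  by_cases hi : i = k
  · subst hi
    simpa using hasDerivAt_const s u
  · simp only [Matrix.updateRow_ne hi]
    change HasDerivAt (fun s : ℝ => H i + s • K i) (K i) s
    simpa using ((hasDerivAt_id s).smul_const (K i)).const_add (H i)

theorem Continuous.detVariation {n : ℕ} {X : Type*} [TopologicalSpace X]
    {H K : X → Matrix (Fin n) (Fin n) ℝ} {u : X → Fin n → ℝ} (hH : Continuous H)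
    (hK : Continuous K) (hu : Continuous u) (k : Fin n) :
    Continuous fun x => detVariation (H x) (K x) (u x) k :=
  continuous_finsetSum _ fun l _ => ((hH.matrix_updateRow k hu).matrix_updateRow l
    ((continuous_apply l).comp (hK.matrix_updateRow k continuous_const))).matrix_det

theorem integral_pd_mul_detVariation {n : ℕ} (hn : 1 ≤ n) {h φ : E n → ℝ}
    (hh : ContDiffOn ℝ 2 h {0}ᶜ) (hφ : ContDiffOn ℝ 2 φ {0}ᶜ) :
    ∫ u : E n, ∑ k, pd h u k * detVariation (hessMat h u) (hessMat φ u) u k ∂sphereMeasure n =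
      ((n : ℝ) - 1) *
        ∫ u : E n, ∑ k, pd φ u k * ((hessMat h u).updateRow k u).det ∂sphereMeasure n := by
  have hS : sphere (0 : E n) 1 ⊆ {0}ᶜ := fun _ => mem_compl_zero_of_mem_sphere
  have hc : ∀ f : E n → ℝ, ContDiffOn ℝ 2 f {0}ᶜ →
      Continuous fun u : sphere (0 : E n) 1 => hessMat f u := fun f hf =>
    continuousOn_iff_continuous_domRestrict.1 ((continuousOn_hessMat hf).mono hS)
  have huc : Continuous fun u : sphere (0 : E n) 1 => (u : E n).ofLp := by fun_prop
  have hpc : ∀ f : E n → ℝ, ContDiffOn ℝ 2 f {0}ᶜ → ∀ k,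
      ContinuousOn (fun u => pd f u k) (sphere 0 1) := fun f hf k =>
    (contDiffOn_pd hf k).continuousOn.mono hS
  have hint1 : ∀ k l, Integrable (fun u : E n => pd h u k *
      (((hessMat h u).updateRow k u).updateRow l ((hessMat φ u).updateRow k 0 l)).det)
      (sphereMeasure n) := fun k l => integrable_sphereMeasure hn ((hpc h hh k).mul
    (continuousOn_iff_continuous_domRestrict.2 (((hc h hh).matrix_updateRow k
      huc).matrix_updateRow l ((continuous_apply l).comp ((hc φ hφ).matrix_updateRow k continuous_const))).matrix_det))
  have hint2 : ∀ k, Integrable (fun u : E n => pd φ u k * ((hessMat h u).updateRow k u).det)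
      (sphereMeasure n) := fun k => integrable_sphereMeasure hn ((hpc φ hφ k).mul
    (continuousOn_iff_continuous_domRestrict.2 ((hc h hh).matrix_updateRow k huc).matrix_det))
  have hterm : ∀ k l, ∫ u : E n, pd h u k *
      (((hessMat h u).updateRow k u).updateRow l ((hessMat φ u).updateRow k 0 l)).det
      ∂sphereMeasure n = if k = l then 0 else
        ∫ u : E n, pd φ u l * ((hessMat h u).updateRow l u).det ∂sphereMeasure n := by
    intro k l
    split_ifs with hkl
    · subst hkl
      refine integral_eq_zero_of_ae (.of_forall fun u => ?_)
      exact mul_eq_zero_of_right _ (Matrix.det_eq_zero_of_row_eq_zero k fun j =>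
        (congrFun Matrix.updateRow_self j).trans (congrFun Matrix.updateRow_self j))
    · simp only [Matrix.updateRow_ne (Ne.symm hkl)]
      exact integral_mul_det_updateRow hn (fun i => contDiffOn_pd hh i) (contDiffOn_pd hφ l) hkl
  simp only [detVariation, Finset.mul_sum]
  rw [integral_finsetSum _ fun k _ => integrable_finsetSum _ fun l _ => hint1 k l,
    integral_finsetSum _ fun k _ => hint2 k]
  simp only [integral_finsetSum _ fun l _ => hint1 _ l, hterm]
  rw [Finset.sum_comm, Finset.mul_sum]
  refine Finset.sum_congr rfl fun l _ => ?_
  rw [← Finset.add_sum_erase _ _ (Finset.mem_univ l), if_pos rfl, zero_add,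
    Finset.sum_congr rfl fun k hk => if_neg (Finset.ne_of_mem_erase hk), Finset.sum_const,
    Finset.card_erase_of_mem (Finset.mem_univ l), Finset.card_univ, Fintype.card_fin, nsmul_eq_mul,
    Nat.cast_sub hn, Nat.cast_one]

/-! ### First and second variation -/

theorem volF_eq {n : ℕ} {h : E n → ℝ} (hom : homog1 h) (hh : ContDiffOn ℝ 2 h {0}ᶜ) :
    volF n h = 1 / n *
      ∫ u : E n, ∑ k, pd h u k * ((hessMat h u).updateRow k u).det ∂sphereMeasure n := by
  rw [volF]
  congr 1
  refine integral_congr_ae ?_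
  filter_upwards [ae_mem_sphere n] with u hu
  rw [sum_pd_mul_det_updateRow hom hh hom hh hu]

theorem hasDerivAt_volF {n : ℕ} (hn : 1 ≤ n) {h φ : E n → ℝ} (hom : homog1 h)
    (hh : ContDiffOn ℝ 2 h {0}ᶜ) (hφhom : homog1 φ) (hφ : ContDiffOn ℝ 2 φ {0}ᶜ) (s : ℝ) :
    HasDerivAt (fun s : ℝ => volF n fun x => h x + s * φ x)
      (∫ u : E n, φ u * sdet (fun x => h x + s * φ x) u ∂sphereMeasure n) s := by
  have hS : sphere (0 : E n) 1 ⊆ {0}ᶜ := fun _ => mem_compl_zero_of_mem_sphere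
  have hd : ∀ f : E n → ℝ, ContDiffOn ℝ 2 f {0}ᶜ → ∀ u ∈ sphere (0 : E n) 1,
      DifferentiableAt ℝ f u := fun f hf u hu =>
    differentiableAt_of_contDiffOn_compl (hf.of_le (by norm_num)) (hS hu)
  have hHc : ∀ f : E n → ℝ, ContDiffOn ℝ 2 f {0}ᶜ →
      ContinuousOn (hessMat f) (sphere 0 1) := fun f hf => (continuousOn_hessMat hf).mono hS
  have hpc : ∀ f : E n → ℝ, ContDiffOn ℝ 2 f {0}ᶜ → ContinuousOn (pd f) (sphere 0 1) :=
    fun f hf => (continuousOn_pd (hf.of_le (by norm_num))).mono hS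
  let G : ℝ → E n → ℝ := fun s u => ∑ k, (pd h u k + s * pd φ u k) *
    ((hessMat h u + s • hessMat φ u).updateRow k u).det
  let G' : ℝ → E n → ℝ := fun s u => ∑ k,
    (pd φ u k * ((hessMat h u + s • hessMat φ u).updateRow k u).det +
      (pd h u k + s * pd φ u k) *
        detVariation (hessMat h u + s • hessMat φ u) (hessMat φ u) u k)
  have hcov : ∀ s, ∀ u ∈ sphere (0 : E n) 1,
      pd (fun x => h x + s * φ x) u = pd h u + s • pd φ u ∧
      hessMat (fun x => h x + s * φ x) u = hessMat h u + s • hessMat φ u := fun s u hu =>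
    ⟨pd_add_const_mul (hd h hh u hu) (hd φ hφ u hu) s, hessMat_add_const_mul hh hφ (hS hu) s⟩
  have hvol : (fun s : ℝ => volF n fun x => h x + s * φ x) =
      fun s => 1 / (n : ℝ) * ∫ u, G s u ∂sphereMeasure n := by
    funext s
    rw [volF_eq (hom.add_const_mul hφhom s) (contDiffOn_add_const_mul hh hφ s)]
    congr 1
    refine integral_congr_ae ?_
    filter_upwards [ae_mem_sphere n] with u hu
    rw [(hcov s u hu).1, (hcov s u hu).2]
    rfl
  have hG : ∀ t, ContinuousOn (G t) (sphere 0 1) := by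
    intro t
    rw [continuousOn_iff_continuous_domRestrict]
    have h1 := continuousOn_iff_continuous_domRestrict.1 (hHc h hh)
    have h2 := continuousOn_iff_continuous_domRestrict.1 (hHc φ hφ)
    have h3 := continuousOn_iff_continuous_domRestrict.1 (hpc h hh)
    have h4 := continuousOn_iff_continuous_domRestrict.1 (hpc φ hφ)
    refine continuous_finsetSum _ fun k _ => ?_
    refine (((continuous_apply k).comp h3).add (continuous_const.mul
      ((continuous_apply k).comp h4))).mul ?_
    exact ((h1.add (h2.const_smul t)).matrix_updateRow k (by fun_prop)).matrix_det
  have hG' : ContinuousOn (fun p : ℝ × E n => G' p.1 p.2) (Set.univ ×ˢ sphere 0 1) := by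
    have hsnd : ∀ {Y : Type} [TopologicalSpace Y] {f : E n → Y}, ContinuousOn f (sphere 0 1) →
        Continuous fun p : (Set.univ : Set ℝ) ×ˢ sphere (0 : E n) 1 => f p.1.2 :=
      fun hf => continuousOn_iff_continuous_domRestrict.1
        (hf.comp continuous_snd.continuousOn fun p hp => hp.2)
    rw [continuousOn_iff_continuous_domRestrict]
    have h1 := hsnd (hHc h hh)
    have h2 := hsnd (hHc φ hφ)
    have h3 := hsnd (hpc h hh)
    have h4 := hsnd (hpc φ hφ)
    have hs : Continuous fun p : (Set.univ : Set ℝ) ×ˢ sphere (0 : E n) 1 => p.1.1 := by fun_prop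
    have hu : Continuous fun p : (Set.univ : Set ℝ) ×ˢ sphere (0 : E n) 1 => p.1.2.ofLp := by
      fun_prop
    have h5 := h1.add (hs.smul h2)
    refine continuous_finsetSum _ fun k _ => ?_
    exact (((continuous_apply k).comp h4).mul (h5.matrix_updateRow k hu).matrix_det).add
      ((((continuous_apply k).comp h3).add (hs.mul ((continuous_apply k).comp h4))).mul
        (h5.detVariation h2 hu k))
  have hder : ∀ t, ∀ u ∈ sphere (0 : E n) 1, HasDerivAt (fun t => G t u) (G' t u) t := by
    intro t u _
    refine HasDerivAt.fun_sum fun k _ => ?_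
    have h1 : HasDerivAt (fun s : ℝ => pd h u k + s * pd φ u k) (pd φ u k) t := by
      simpa using ((hasDerivAt_id t).mul_const (pd φ u k)).const_add (pd h u k)
    exact h1.mul (hasDerivAt_det_updateRow (hessMat h u) (hessMat φ u) u k t)
  have key := (hasDerivAt_integral_sphere hn hG hG' hder s).const_mul (1 / (n : ℝ))
  rw [hvol]
  refine key.congr_deriv ?_
  have hhs := contDiffOn_add_const_mul hh hφ s
  set hs : E n → ℝ := fun x => h x + s * φ x with hs_def
  have hφs : ContinuousOn (fun u : E n => ∑ k, pd φ u k * ((hessMat hs u).updateRow k u).det)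
      (sphere 0 1) := by
    rw [continuousOn_iff_continuous_domRestrict]
    have h1 := continuousOn_iff_continuous_domRestrict.1 (hHc hs hhs)
    have h4 := continuousOn_iff_continuous_domRestrict.1 (hpc φ hφ)
    exact continuous_finsetSum _ fun k _ => ((continuous_apply k).comp h4).mul
      (h1.matrix_updateRow k (by fun_prop)).matrix_det
  have hvs : ContinuousOn
      (fun u : E n => ∑ k, pd hs u k * detVariation (hessMat hs u) (hessMat φ u) u k)
      (sphere 0 1) := by
    rw [continuousOn_iff_continuous_domRestrict]
    have h1 := continuousOn_iff_continuous_domRestrict.1 (hHc hs hhs)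
    have h2 := continuousOn_iff_continuous_domRestrict.1 (hHc φ hφ)
    have h4 := continuousOn_iff_continuous_domRestrict.1 (hpc hs hhs)
    exact continuous_finsetSum _ fun k _ => ((continuous_apply k).comp h4).mul
      (h1.detVariation h2 (by fun_prop) k)
  have hsplit : ∫ u, G' s u ∂sphereMeasure n =
      ∫ u : E n, ∑ k, pd φ u k * ((hessMat hs u).updateRow k u).det ∂sphereMeasure n +
      ∫ u : E n, ∑ k, pd hs u k * detVariation (hessMat hs u) (hessMat φ u) u k
        ∂sphereMeasure n := by
    rw [← integral_add (integrable_sphereMeasure hn hφs) (integrable_sphereMeasure hn hvs)]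
    refine integral_congr_ae ?_
    filter_upwards [ae_mem_sphere n] with u hu
    rw [← Finset.sum_add_distrib, hs_def, (hcov s u hu).1, (hcov s u hu).2]
    rfl
  have hfin : ∫ u : E n, ∑ k, pd φ u k * ((hessMat hs u).updateRow k u).det ∂sphereMeasure n =
      ∫ u : E n, φ u * sdet hs u ∂sphereMeasure n := by
    refine integral_congr_ae ?_
    filter_upwards [ae_mem_sphere n] with u hu
    rw [sum_pd_mul_det_updateRow (hom.add_const_mul hφhom s) hhs hφhom hφ hu]
  rw [hsplit, integral_pd_mul_detVariation hn hhs hφ, hfin]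
  have hn0 : (n : ℝ) ≠ 0 := by positivity
  field_simp
  ring

theorem det_ne_zero_of_memC {n : ℕ} {h : E n → ℝ} (hC : memC n h) {u : E n}
    (hu : u ∈ sphere (0 : E n) 1) : (hessMat h u + Matrix.vecMulVec u u).det ≠ 0 := by
  obtain ⟨hom, hh, hpos⟩ := hC
  have hu0 := mem_compl_zero_of_mem_sphere hu
  intro h0
  obtain ⟨v, hv, hMv⟩ := Matrix.exists_mulVec_eq_zero_iff.2 h0
  have hMv' : ∀ i, ∑ j, hessMat h u i j * v j + u i * ∑ j, u j * v j = 0 := by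
    intro i
    have := congrFun hMv i
    simpa [Matrix.mulVec, dotProduct, Matrix.vecMulVec_apply, add_mul, Finset.sum_add_distrib,
      Finset.mul_sum, mul_assoc] using this
  have huH : ∑ i, u i * ∑ j, hessMat h u i j * v j = 0 := by
    simp only [Finset.mul_sum]
    rw [Finset.sum_comm]
    refine Finset.sum_eq_zero fun j _ => ?_
    calc ∑ i, u i * (hessMat h u i j * v j) = (∑ i, hessMat h u j i * u i) * v j := by
          rw [Finset.sum_mul]
          refine Finset.sum_congr rfl fun i _ => ?_
          rw [hessMat_symm hh hu0 i j]; ring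
      _ = 0 := by rw [hessMat_mulVec_self hom hh hu0, zero_mul]
  have hc : ∑ j, u j * v j = 0 := by
    have h1 : ∑ i, u i * (∑ j, hessMat h u i j * v j + u i * ∑ j, u j * v j) = 0 :=
      Finset.sum_eq_zero fun i _ => by rw [hMv' i, mul_zero]
    simp only [mul_add, Finset.sum_add_distrib, ← mul_assoc] at h1
    rwa [← Finset.sum_mul, sum_mul_self_of_mem_sphere hu, one_mul,
      show ∑ i, u i * ∑ j, hessMat h u i j * v j = 0 from huH, zero_add] at h1
  have hperp : WithLp.toLp 2 v ∈ (ℝ ∙ u)ᗮ := by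
    rw [Submodule.mem_orthogonal_singleton_iff_inner_right, inner_eq_sum]
    exact hc
  have hAv : sHess h u (WithLp.toLp 2 v) = 0 := by
    ext i
    rw [sHess_apply hh hu0]
    have := hMv' i
    rw [hc, mul_zero, add_zero] at this
    exact this
  have := hpos u hu _ hperp (by simpa using hv)
  rw [hAv, inner_zero_left] at this
  exact this.false

/-- Jacobi's formula on the tangent space, in terms of the tangential cofactor endomorphism. -/
theorem sum_det_updateRow_eq_trace {n : ℕ} {h φ : E n → ℝ} (hC : memC n h)
    (hφhom : homog1 φ) (hφ : ContDiffOn ℝ 2 φ {0}ᶜ) {u : E n} (hu : u ∈ sphere (0 : E n) 1)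
    (C : E n →L[ℝ] E n) (hCtan : ∀ v : E n, C v ∈ (ℝ ∙ u)ᗮ)
    (hCinv : (sHess h u).comp C = sdet h u • tproj u) :
    ∑ l, ((hessMat h u + Matrix.vecMulVec u u).updateRow l (hessMat φ u l)).det =
      LinearMap.trace ℝ (E n) ((C.comp (sHess φ u) : E n →L[ℝ] E n) : E n →ₗ[ℝ] E n) := by
  have hu0 := mem_compl_zero_of_mem_sphere hu
  obtain ⟨hom, hh, -⟩ := id hC
  set M := hessMat h u + Matrix.vecMulVec u u with hM
  let b := (EuclideanSpace.basisFun (Fin n) ℝ).toBasis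
  let c := LinearMap.toMatrix b b (C : E n →ₗ[ℝ] E n)
  have hK : ∀ f : E n → ℝ, ContDiffOn ℝ 2 f {0}ᶜ →
      LinearMap.toMatrix b b (sHess f u : E n →ₗ[ℝ] E n) = hessMat f u := by
    intro f hf
    ext i j
    rw [LinearMap.toMatrix_apply]
    simp [b, sHess_apply hf hu0]
  have hHc : hessMat h u * c = M.det • (1 - Matrix.vecMulVec u u) := by
    rw [← hK h hh, ← LinearMap.toMatrix_mul]
    have h1 : (sHess h u : E n →ₗ[ℝ] E n) * (C : E n →ₗ[ℝ] E n) =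
        (sdet h u • tproj u : E n →L[ℝ] E n) := by
      rw [← hCinv]; rfl
    rw [h1, sdet_eq_det hom hh hu]
    ext i j
    rw [LinearMap.toMatrix_apply]
    simp [b, tproj_apply, EuclideanSpace.inner_single_right, Matrix.vecMulVec_apply,
      Matrix.one_apply, mul_comm]
    exact Or.inl rfl
  have huc : Matrix.vecMulVec u u * c = 0 := by
    have h1 : Matrix.vecMul u c = 0 := by
      funext j
      have := Submodule.mem_orthogonal_singleton_iff_inner_right.1 (hCtan (b j))
      rw [inner_eq_sum] at this
      simpa [Matrix.vecMul, dotProduct, c, LinearMap.toMatrix_apply, b] using this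
    rw [Matrix.vecMulVec_mul, h1]
    ext; simp [Matrix.vecMulVec_apply]
  have hMc : c = M.adjugate * (1 - Matrix.vecMulVec u u) := by
    have h1 : M * c = M.det • (1 - Matrix.vecMulVec u u) := by
      rw [hM, Matrix.add_mul, huc, add_zero, ← hM, hHc]
    have h2 : M.det • c = M.det • (M.adjugate * (1 - Matrix.vecMulVec u u)) := by
      rw [← Matrix.mul_smul, ← h1, ← Matrix.mul_assoc, Matrix.adjugate_mul, Matrix.smul_mul,
        Matrix.one_mul]
    exact smul_right_injective _ (det_ne_zero_of_memC hC hu) h2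
  have huK : Matrix.vecMulVec u u * hessMat φ u = 0 := by
    have h1 : Matrix.vecMul u (hessMat φ u) = 0 := by
      funext j
      rw [Pi.zero_apply, ← hessMat_mulVec_self hφhom hφ hu0 j]
      change ∑ i, u i * hessMat φ u i j = _
      exact Finset.sum_congr rfl fun i _ => by rw [hessMat_symm hφ hu0 i j, mul_comm]
    rw [Matrix.vecMulVec_mul, h1]
    ext; simp [Matrix.vecMulVec_apply]
  rw [LinearMap.trace_eq_matrix_trace ℝ b]
  have h3 : LinearMap.toMatrix b b ((C.comp (sHess φ u) : E n →L[ℝ] E n) : E n →ₗ[ℝ] E n) =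
      M.adjugate * hessMat φ u := by
    have : ((C.comp (sHess φ u) : E n →L[ℝ] E n) : E n →ₗ[ℝ] E n) =
      (C : E n →ₗ[ℝ] E n) * (sHess φ u : E n →ₗ[ℝ] E n) := rfl
    rw [this, LinearMap.toMatrix_mul, hK φ hφ]
    change c * _ = _
    rw [hMc, Matrix.mul_assoc, Matrix.sub_mul, Matrix.one_mul, huK, sub_zero]
  rw [h3, Matrix.trace_mul_comm, Matrix.trace]
  refine Finset.sum_congr rfl fun l _ => ?_
  rw [det_updateRow_eq_sum, Matrix.diag_apply, Matrix.mul_apply]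
  simp only [Matrix.adjugate_apply]

theorem hasDerivAt_integral_mul_sdet {n : ℕ} (hn : 1 ≤ n) {h φ : E n → ℝ} (hom : homog1 h)
    (hh : ContDiffOn ℝ 2 h {0}ᶜ) (hφhom : homog1 φ) (hφ : ContDiffOn ℝ 2 φ {0}ᶜ) :
    HasDerivAt (fun s : ℝ => ∫ u : E n, φ u * sdet (fun x => h x + s * φ x) u ∂sphereMeasure n)
      (∫ u : E n, φ u *
        ∑ l, ((hessMat h u + Matrix.vecMulVec u u).updateRow l (hessMat φ u l)).det
        ∂sphereMeasure n) 0 := by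
  have hS : sphere (0 : E n) 1 ⊆ {0}ᶜ := fun _ => mem_compl_zero_of_mem_sphere
  have hHc : ∀ f : E n → ℝ, ContDiffOn ℝ 2 f {0}ᶜ →
      ContinuousOn (hessMat f) (sphere 0 1) := fun f hf => (continuousOn_hessMat hf).mono hS
  have hφc : ContinuousOn φ (sphere 0 1) := hφ.continuousOn.mono hS
  let M : ℝ → E n → Matrix (Fin n) (Fin n) ℝ := fun s u =>
    hessMat h u + s • hessMat φ u + Matrix.vecMulVec u u
  have hfun : (fun s : ℝ => ∫ u : E n, φ u * sdet (fun x => h x + s * φ x) u ∂sphereMeasure n) =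
      fun s => ∫ u : E n, φ u * (M s u).det ∂sphereMeasure n := by
    funext s
    refine integral_congr_ae ?_
    filter_upwards [ae_mem_sphere n] with u hu
    rw [sdet_eq_det (hom.add_const_mul hφhom s) (contDiffOn_add_const_mul hh hφ s) hu,
      hessMat_add_const_mul hh hφ (hS hu) s]
  rw [hfun]
  have key := hasDerivAt_integral_sphere hn (G := fun s u => φ u * (M s u).det)
    (G' := fun s u => φ u * ∑ l, ((M s u).updateRow l (hessMat φ u l)).det) ?_ ?_ ?_ 0
  · simpa [M] using key
  · intro s
    rw [continuousOn_iff_continuous_domRestrict]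
    have h1 := continuousOn_iff_continuous_domRestrict.1 (hHc h hh)
    have h2 := continuousOn_iff_continuous_domRestrict.1 (hHc φ hφ)
    have hu : Continuous fun u : sphere (0 : E n) 1 => (u : E n).ofLp := by fun_prop
    exact (continuousOn_iff_continuous_domRestrict.1 hφc).mul
      ((h1.add (h2.const_smul s)).add (hu.matrix_vecMulVec hu)).matrix_det
  · have hsnd : ∀ {Y : Type} [TopologicalSpace Y] {f : E n → Y}, ContinuousOn f (sphere 0 1) →
        Continuous fun p : (Set.univ : Set ℝ) ×ˢ sphere (0 : E n) 1 => f p.1.2 :=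
      fun hf => continuousOn_iff_continuous_domRestrict.1
        (hf.comp continuous_snd.continuousOn fun p hp => hp.2)
    rw [continuousOn_iff_continuous_domRestrict]
    have h1 := hsnd (hHc h hh)
    have h2 := hsnd (hHc φ hφ)
    have hs : Continuous fun p : (Set.univ : Set ℝ) ×ˢ sphere (0 : E n) 1 => p.1.1 := by fun_prop
    have hu : Continuous fun p : (Set.univ : Set ℝ) ×ˢ sphere (0 : E n) 1 => p.1.2.ofLp := by
      fun_prop
    exact (hsnd hφc).mul (continuous_finsetSum _ fun l _ =>
      (((h1.add (hs.smul h2)).add (hu.matrix_vecMulVec hu)).matrix_updateRow l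
        ((continuous_apply l).comp h2)).matrix_det)
  · intro t u _
    refine (hasDerivAt_det (r' := hessMat φ u) fun i => ?_).const_mul (φ u)
    change HasDerivAt (fun s : ℝ => hessMat h u i + s • hessMat φ u i + Matrix.vecMulVec u u i)
      (hessMat φ u i) t
    simpa using (((hasDerivAt_id t).smul_const (hessMat φ u i)).const_add (hessMat h u i)).add_const
      (Matrix.vecMulVec u u i)

end

/-- Proposition 3.3:  Let `h ∈ 𝒞`, let `φ ∈ C^∞(S^{n-1})` (represented by its smooth
`1`-homogeneous extension) and let `ε > 0` be such that `h + sφ ∈ 𝒞` for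
`s ∈ (-ε, ε)`; set `f(s) = F(h + sφ)`.  Then
`f''(0) = ∫_{S^{n-1}} φ Σ_{i,j} c_ij (φ_ij + φ δ_ij) dℋ^{n-1}`,
where `(c_ij)` is the cofactor matrix of `(h_ij + h δ_ij)`, represented by the
endomorphism field `Cof` characterized by the hypotheses `hCtan`, `hCinv`; the
contraction `Σ_{i,j} c_ij (φ_ij + φ δ_ij)` equals the trace of `(Cof u) ∘ (sHess φ u)`,
since the restriction of `sHess φ u` to `u^⊥` is the matrix `(φ_ij + φ δ_ij)`. -/
theorem volF_second_variation
    {n : ℕ} (hn : 2 ≤ n) (h φ : E n → ℝ) (hh : memC n h)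
    (hφhom : homog1 φ) (hφ : ContDiffOn ℝ (⊤ : ℕ∞) φ {(0 : E n)}ᶜ)
    (ε : ℝ) (hε : 0 < ε)
    (hs : ∀ s ∈ Set.Ioo (-ε) ε, memC n (fun x => h x + s * φ x))
    (Cof : E n → E n →L[ℝ] E n)
    (hCtan : ∀ u ∈ sphere (0 : E n) 1, ∀ v : E n, Cof u v ∈ (ℝ ∙ u)ᗮ)
    (hCinv : ∀ u ∈ sphere (0 : E n) 1, (sHess h u).comp (Cof u) = sdet h u • tproj u) :
    deriv (deriv (fun s : ℝ => volF n (fun x => h x + s * φ x))) 0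
      = ∫ u in sphere (0 : E n) 1,
          φ u * LinearMap.trace ℝ (E n) (((Cof u).comp (sHess φ u) : E n →L[ℝ] E n) :
            E n →ₗ[ℝ] E n) ∂μH[(n : ℝ) - 1] := by
  have hn1 : 1 ≤ n := le_trans one_le_two hn
  have hφ2 : ContDiffOn ℝ 2 φ {0}ᶜ := contDiffOn_infty.1 hφ 2
  have h1 : deriv (fun s : ℝ => volF n (fun x => h x + s * φ x)) =
      fun s => ∫ u : E n, φ u * sdet (fun x => h x + s * φ x) u ∂sphereMeasure n :=
    funext fun s => (hasDerivAt_volF hn1 hh.1 hh.2.1 hφhom hφ2 s).deriv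
  rw [h1, (hasDerivAt_integral_mul_sdet hn1 hh.1 hh.2.1 hφhom hφ2).deriv]
  refine integral_congr_ae ?_
  filter_upwards [ae_mem_sphere n] with u hu
  rw [sum_det_updateRow_eq_trace hh hφhom hφ2 hu (Cof u) (hCtan u hu) (hCinv u hu)]
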